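/- For all integers a ≥ 2, b ≥ 1, k ≥ 1, l_1, …, l_k ≥ 1 and any assignment α as in the construction, with n = a + 2b − 1 + Σ_{j=1}^k l_j, there is no smooth Fano n-polytope Q with n + k + 2 vertices such that V(Q) ⊆ V(P(a, b, k, l, α)). -/

import Mathlib

/-! ## Basic definitions: lattice polytopes, smooth Fano polytopes,
unimodular equivalence, F- and I-equivalence, primitive collections. -/

/-- A point of `ℝ^n` all of whose coordinates are integers. -/
def IsLatticePoint {n : ℕ} (x : Fin n → ℝ) : Prop := ∀ i, ∃ m : ℤ, x i = (m : ℝ)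

/-- The vertex set of a polytope: its extreme points. -/
def vertexSet {n : ℕ} (P : Set (Fin n → ℝ)) : Set (Fin n → ℝ) :=
  Set.extremePoints ℝ P

/-- A lattice `n`-polytope: the convex hull of finitely many lattice points,
of full dimension `n`. -/
def IsLatticePolytope {n : ℕ} (P : Set (Fin n → ℝ)) : Prop :=
  (∃ S : Finset (Fin n → ℝ), (∀ x ∈ S, IsLatticePoint x) ∧
    P = convexHull ℝ (S : Set (Fin n → ℝ))) ∧
  affineSpan ℝ P = ⊤

/-- A face of `P`: an exposed subset of `P`. -/
def IsFaceOf {n : ℕ} (F P : Set (Fin n → ℝ)) : Prop := IsExposed ℝ P F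

/-- A facet of `P`: a face of affine dimension `n - 1`. -/
def IsFacetOf {n : ℕ} (F P : Set (Fin n → ℝ)) : Prop :=
  IsFaceOf F P ∧ Module.finrank ℝ (vectorSpan ℝ F) + 1 = n

/-- A set `S` of points of `ℝ^n` forms a `ℤ`-basis of `ℤ^n`:
it consists of `n` lattice points whose matrix has determinant `±1`. -/
def IsUnimodularBasis {n : ℕ} (S : Set (Fin n → ℝ)) : Prop :=
  ∃ b : Fin n → (Fin n → ℝ), Function.Injective b ∧ Set.range b = S ∧
    (∀ i, IsLatticePoint (b i)) ∧ |(Matrix.of b).det| = 1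

/-- A smooth Fano `n`-polytope: a lattice `n`-polytope with the origin in its
interior such that the vertex set of every facet is a `ℤ`-basis of `ℤ^n`. -/
def IsSmoothFano {n : ℕ} (P : Set (Fin n → ℝ)) : Prop :=
  IsLatticePolytope P ∧ (0 : Fin n → ℝ) ∈ interior P ∧
    ∀ F : Set (Fin n → ℝ), IsFacetOf F P → IsUnimodularBasis (vertexSet P ∩ F)

/-- Two subsets of `ℝ^n` are unimodularly equivalent if an affine map of `ℝ^n`
mapping `ℤ^n` onto `ℤ^n` maps one onto the other. -/
def UnimodularEquiv {n : ℕ} (Q Q' : Set (Fin n → ℝ)) : Prop :=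
  ∃ φ : (Fin n → ℝ) →ᵃ[ℝ] (Fin n → ℝ),
    φ '' {x | IsLatticePoint x} = {x | IsLatticePoint x} ∧ φ '' Q = Q'

/-- One step of an I-sequence: the vertex set of one polytope is obtained from
the vertex set of the other by adding one new lattice point. -/
def IStep {n : ℕ} (P Q : Set (Fin n → ℝ)) : Prop :=
  (∃ w : Fin n → ℝ, IsLatticePoint w ∧ w ∉ vertexSet P ∧
    vertexSet Q = vertexSet P ∪ {w}) ∨
  (∃ w : Fin n → ℝ, IsLatticePoint w ∧ w ∉ vertexSet Q ∧
    vertexSet P = vertexSet Q ∪ {w})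

/-- I-equivalence of smooth Fano `n`-polytopes. -/
def IEquiv {n : ℕ} (P Q : Set (Fin n → ℝ)) : Prop :=
  ∃ (k : ℕ) (c : Fin (k + 1) → Set (Fin n → ℝ)),
    (∀ i, IsSmoothFano (c i)) ∧
    UnimodularEquiv P (c 0) ∧ UnimodularEquiv Q (c (Fin.last k)) ∧
    ∀ i : Fin k, IStep (c i.castSucc) (c i.succ)

/-- `Q` is the stellar subdivision of `P` at the new vertex `w`: `w` is the sum
of the vertices of a proper face `F` of `P`, and the facets of `Q` containing
`w` are exactly the sets `conv({w} ∪ (V(F') \ {v}))` for `F'` a facet of `P`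
containing `F` and `v` a vertex of `F`. -/
def IsStellarSubdivisionAt {n : ℕ} (P Q : Set (Fin n → ℝ)) (w : Fin n → ℝ) : Prop :=
  ∃ F : Set (Fin n → ℝ), IsFaceOf F P ∧ F.Nonempty ∧ F ≠ P ∧
    w = ∑ᶠ v ∈ vertexSet P ∩ F, v ∧
    {G : Set (Fin n → ℝ) | IsFacetOf G Q ∧ w ∈ G} =
      {G : Set (Fin n → ℝ) | ∃ F' v, IsFacetOf F' P ∧ F ⊆ F' ∧
        v ∈ vertexSet P ∩ F ∧
        G = convexHull ℝ (insert w ((vertexSet P ∩ F') \ {v}))}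

/-- One step of an F-sequence: an I-step which moreover is a stellar
subdivision (or its inverse). -/
def FStep {n : ℕ} (P Q : Set (Fin n → ℝ)) : Prop :=
  (∃ w : Fin n → ℝ, IsLatticePoint w ∧ w ∉ vertexSet P ∧
    vertexSet Q = vertexSet P ∪ {w} ∧ IsStellarSubdivisionAt P Q w) ∨
  (∃ w : Fin n → ℝ, IsLatticePoint w ∧ w ∉ vertexSet Q ∧
    vertexSet P = vertexSet Q ∪ {w} ∧ IsStellarSubdivisionAt Q P w)

/-- F-equivalence of smooth Fano `n`-polytopes. -/
def FEquiv {n : ℕ} (P Q : Set (Fin n → ℝ)) : Prop :=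
  ∃ (k : ℕ) (c : Fin (k + 1) → Set (Fin n → ℝ)),
    (∀ i, IsSmoothFano (c i)) ∧
    UnimodularEquiv P (c 0) ∧ UnimodularEquiv Q (c (Fin.last k)) ∧
    ∀ i : Fin k, FStep (c i.castSucc) (c i.succ)

/-- A smooth Fano polytope is F-isolated if every smooth Fano polytope
F-equivalent to it is unimodularly equivalent to it. -/
def FIsolated {n : ℕ} (P : Set (Fin n → ℝ)) : Prop :=
  ∀ Q : Set (Fin n → ℝ), IsSmoothFano Q → FEquiv Q P → UnimodularEquiv Q P

/-- A smooth Fano polytope is I-isolated if every smooth Fano polytope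
I-equivalent to it is unimodularly equivalent to it. -/
def IIsolated {n : ℕ} (P : Set (Fin n → ℝ)) : Prop :=
  ∀ Q : Set (Fin n → ℝ), IsSmoothFano Q → IEquiv Q P → UnimodularEquiv Q P

/-- A primitive collection of a smooth Fano polytope `P`: a nonempty set `A` of
vertices such that `conv(A)` is not a face of `P` but `conv(A \ {x})` is a face
of `P` for every `x ∈ A`. -/
def IsPrimitiveCollection {n : ℕ} (P A : Set (Fin n → ℝ)) : Prop :=
  A.Nonempty ∧ A ⊆ vertexSet P ∧ ¬ IsFaceOf (convexHull ℝ A) P ∧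
    ∀ x ∈ A, IsFaceOf (convexHull ℝ (A \ {x})) P

/-- The standard basis vector `e_i` of `ℝ^n`. -/
def stdBasis {n : ℕ} (i : Fin n) : Fin n → ℝ := fun q => if q = i then 1 else 0

/-- The polytope `T^n = conv{e_1, …, e_n, -(e_1 + ⋯ + e_n)}`,
corresponding to projective `n`-space. -/
def Tpoly (n : ℕ) : Set (Fin n → ℝ) :=
  convexHull ℝ (Set.range (stdBasis (n := n)) ∪ {fun _ => (-1 : ℝ)})

namespace PG

/-! The concrete polytope `P(a, b, k, l, α)` of dimension
`n = a + 2b - 1 + l_1 + ⋯ + l_k`, from the proof of Theorem `general`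
(coordinates are `0`-based: the paper's `e_q` is the standard basis vector at
index `q - 1`). An assignment `α j i : Fin b ⊕ Fin b` names the vertex
`α_{i,j}`, namely `y_{q+1}` for `Sum.inl q` and `u_{q+1}` for `Sum.inr q`. -/

/-- The dimension `n = a + 2b - 1 + ∑ l_j`. -/
def dim (a b k : ℕ) (l : Fin k → ℕ) : ℕ := a + 2 * b - 1 + ∑ j, l j

/-- `v_i = e_i` for `1 ≤ i ≤ a-1`, and
`v_a = -e_1 - ⋯ - e_{a+2b-2} + (a+b-1) e_{a+2b-1}`. -/
def v (a b k : ℕ) (l : Fin k → ℕ) (i : Fin a) : Fin (dim a b k l) → ℝ :=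
  if i.val < a - 1 then fun q => if q.val = i.val then 1 else 0
  else fun q => if q.val = a + 2 * b - 2 then ((a + b - 1 : ℕ) : ℝ)
    else if q.val < a + 2 * b - 2 then -1 else 0

/-- `y_j = e_{a-1+j}` for `1 ≤ j ≤ b-1`, and `y_b = e_{a+b-1} + ⋯ + e_{a+2b-2}`. -/
def y (a b k : ℕ) (l : Fin k → ℕ) (j : Fin b) : Fin (dim a b k l) → ℝ :=
  if j.val < b - 1 then fun q => if q.val = a - 1 + j.val then 1 else 0
  else fun q => if a + b - 2 ≤ q.val ∧ q.val ≤ a + 2 * b - 3 then 1 else 0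

/-- `z = -e_{a+2b-1}`. -/
def z (a b k : ℕ) (l : Fin k → ℕ) : Fin (dim a b k l) → ℝ :=
  fun q => if q.val = a + 2 * b - 2 then -1 else 0

/-- `t = e_{a+2b-1}`. -/
def t (a b k : ℕ) (l : Fin k → ℕ) : Fin (dim a b k l) → ℝ :=
  fun q => if q.val = a + 2 * b - 2 then 1 else 0

/-- `u_j = e_{a+b-1+j}` for `1 ≤ j ≤ b-1`, and
`u_b = e_a + ⋯ + e_{a+b-1} - e_{a+2b-1}`. -/
def u (a b k : ℕ) (l : Fin k → ℕ) (j : Fin b) : Fin (dim a b k l) → ℝ :=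
  if j.val < b - 1 then fun q => if q.val = a + b - 1 + j.val then 1 else 0
  else fun q => if a - 1 ≤ q.val ∧ q.val ≤ a + b - 2 then 1
    else if q.val = a + 2 * b - 2 then -1 else 0

/-- `l_1 + ⋯ + l_{j-1}`. -/
def Lprev (k : ℕ) (l : Fin k → ℕ) (j : Fin k) : ℕ :=
  ∑ j' ∈ Finset.univ.filter (fun j' => j' < j), l j'

/-- The vertex `α_{i,j} ∈ {y_1, …, y_b, u_1, …, u_b}` named by `α j i`. -/
def A (a b k : ℕ) (l : Fin k → ℕ) (α : (j : Fin k) → Fin (l j) → (Fin b ⊕ Fin b))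
    (j : Fin k) (i : Fin (l j)) : Fin (dim a b k l) → ℝ :=
  Sum.elim (y a b k l) (u a b k l) (α j i)

/-- `w_{i,j} = e_{a+2b-1+l_1+⋯+l_{j-1}+i}` for `1 ≤ i ≤ l_j`, and
`w_{l_j+1,j} = -(e_{a+2b-1+l_1+⋯+l_{j-1}+1} + ⋯ + e_{a+2b-1+l_1+⋯+l_j})
+ α_{1,j} + ⋯ + α_{l_j,j}`. -/
def w (a b k : ℕ) (l : Fin k → ℕ) (α : (j : Fin k) → Fin (l j) → (Fin b ⊕ Fin b))
    (j : Fin k) (i : Fin (l j + 1)) : Fin (dim a b k l) → ℝ :=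
  if i.val < l j then
    fun q => if q.val = a + 2 * b - 1 + Lprev k l j + i.val then 1 else 0
  else
    fun q => (∑ i' : Fin (l j), A a b k l α j i' q) -
      (if a + 2 * b - 1 + Lprev k l j ≤ q.val ∧
          q.val < a + 2 * b - 1 + Lprev k l j + l j then 1 else 0)

/-- The polytope `P(a, b, k, l, α)`. -/
def P (a b k : ℕ) (l : Fin k → ℕ)
    (α : (j : Fin k) → Fin (l j) → (Fin b ⊕ Fin b)) :
    Set (Fin (dim a b k l) → ℝ) :=
  convexHull ℝ
    (Set.range (v a b k l) ∪ Set.range (y a b k l) ∪ {z a b k l, t a b k l} ∪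
      Set.range (u a b k l) ∪ ⋃ j, Set.range (w a b k l α j))

end PG

/-! ## Convex geometry of smooth Fano polytopes -/

section ConvexGeometry

open scoped Matrix

lemma finite_vertexSet {n : ℕ} {Q : Set (Fin n → ℝ)} (hQ : IsLatticePolytope Q) :
    (vertexSet Q).Finite := by
  obtain ⟨⟨S, -, rfl⟩, -⟩ := hQ
  exact S.finite_toSet.subset extremePoints_convexHull_subset

lemma isLatticePoint_of_mem_vertexSet {n : ℕ} {Q : Set (Fin n → ℝ)} (hQ : IsLatticePolytope Q)
    {f : Fin n → ℝ} (hf : f ∈ vertexSet Q) : IsLatticePoint f := by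
  obtain ⟨⟨S, hS, rfl⟩, -⟩ := hQ
  exact hS f (extremePoints_convexHull_subset hf)

lemma convexHull_vertexSet {n : ℕ} {Q : Set (Fin n → ℝ)} (hQ : IsLatticePolytope Q) :
    convexHull ℝ (vertexSet Q) = Q := by
  have hfin := finite_vertexSet hQ
  obtain ⟨⟨S, -, rfl⟩, -⟩ := hQ
  rw [← (hfin.isClosed_convexHull ℝ).closure_eq]
  exact closure_convexHull_extremePoints (S.finite_toSet.isCompact_convexHull ℝ)
    (convex_convexHull ℝ _)

/-- If the origin is interior to the convex hull of a finite set, it is a strictly positive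
combination of the points of that set. -/
lemma exists_pos_relation {n : ℕ} (V : Finset (Fin n → ℝ))
    (h0 : (0 : Fin n → ℝ) ∈ interior (convexHull ℝ (V : Set (Fin n → ℝ)))) :
    ∃ c : (Fin n → ℝ) → ℝ, (∀ f, 0 < c f) ∧ ∑ f ∈ V, c f • f = 0 := by
  have hcont : Filter.Tendsto (fun ε : ℝ => (-ε) • ∑ f ∈ V, f) (nhdsWithin 0 (Set.Ioi 0))
      (nhds 0) := by
    have : Continuous (fun ε : ℝ => (-ε) • ∑ f ∈ V, f) := by fun_prop
    have h := this.tendsto 0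
    simp only [neg_zero, zero_smul] at h
    exact h.mono_left nhdsWithin_le_nhds
  have hev := hcont.eventually (mem_interior_iff_mem_nhds.1 h0)
  obtain ⟨ε, hmem, hε⟩ := (hev.and self_mem_nhdsWithin).exists
  obtain ⟨w, hw, -, hsum⟩ := Finset.mem_convexHull'.1 hmem
  refine ⟨fun f => if f ∈ V then w f + ε else 1, fun f => ?_, ?_⟩
  · dsimp only
    split_ifs with hf
    · exact add_pos_of_nonneg_of_pos (hw f hf) hε
    · exact one_pos
  · rw [Finset.sum_congr rfl (g := fun f => w f • f + ε • f)
      (fun f hf => by dsimp only; rw [if_pos hf, add_smul]), Finset.sum_add_distrib,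
      hsum, ← Finset.smul_sum]
    simp

/-- The linear functional `x ↦ x ⬝ᵥ H`. -/
def dotRight {n : ℕ} (H : Fin n → ℝ) : (Fin n → ℝ) →ₗ[ℝ] ℝ where
  toFun x := x ⬝ᵥ H
  map_add' x y := add_dotProduct x y H
  map_smul' c x := smul_dotProduct c x H

@[simp] lemma dotRight_apply {n : ℕ} (H x : Fin n → ℝ) : dotRight H x = x ⬝ᵥ H := rfl

/-- The polar of a finite set. -/
def polarSet {n : ℕ} (V : Finset (Fin n → ℝ)) : Set (Fin n → ℝ) :=
  {H | ∀ f ∈ V, f ⬝ᵥ H ≤ 1}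

lemma dotProduct_le_one_of_mem_convexHull {n : ℕ} {V : Finset (Fin n → ℝ)} {H x : Fin n → ℝ}
    (hH : H ∈ polarSet V) (hx : x ∈ convexHull ℝ (V : Set (Fin n → ℝ))) : x ⬝ᵥ H ≤ 1 := by
  have hconv : Convex ℝ {x : Fin n → ℝ | dotRight H x ≤ 1} :=
    convex_halfSpace_le (dotRight H).isLinear 1
  exact convexHull_min (fun f hf => hH f hf) hconv hx

lemma isCompact_polarSet {n : ℕ} {V : Finset (Fin n → ℝ)}
    (h0 : (0 : Fin n → ℝ) ∈ interior (convexHull ℝ (V : Set (Fin n → ℝ)))) :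
    IsCompact (polarSet V) := by
  refine Metric.isCompact_of_isClosed_isBounded ?_ ?_
  · have : polarSet V = ⋂ f ∈ V, {H : Fin n → ℝ | f ⬝ᵥ H ≤ 1} := by
      ext H; simp [polarSet]
    rw [this]
    refine isClosed_biInter fun f _ => isClosed_le ?_ continuous_const
    exact (Continuous.dotProduct continuous_const continuous_id)
  · obtain ⟨r, hr, hball⟩ := Metric.mem_nhds_iff.1 (mem_interior_iff_mem_nhds.1 h0)
    refine (Metric.isBounded_iff_subset_closedBall 0).2 ⟨2 / r, fun H hH => ?_⟩
    rw [mem_closedBall_zero_iff, pi_norm_le_iff_of_nonneg (by positivity)]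
    intro i
    have key : ∀ s : ℝ, |s| = r / 2 → s * H i ≤ 1 := by
      intro s hs
      have hmem : (Pi.single i s : Fin n → ℝ) ∈ Metric.ball (0 : Fin n → ℝ) r := by
        rw [mem_ball_zero_iff, Pi.norm_single, Real.norm_eq_abs, hs]; linarith
      have := dotProduct_le_one_of_mem_convexHull hH (hball hmem)
      rwa [single_dotProduct] at this
    have h1 := key (r / 2) (abs_of_pos (by positivity))
    have h2 := key (-(r / 2)) (by rw [abs_neg]; exact abs_of_pos (by positivity))
    rw [Real.norm_eq_abs, abs_le, le_div_iff₀ hr, neg_le, le_div_iff₀ hr]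
    constructor <;> nlinarith

lemma exists_pos_add_smul_mem_polarSet {n : ℕ} {V : Finset (Fin n → ℝ)} {H d : Fin n → ℝ}
    (hH : H ∈ polarSet V) (hd : ∀ f ∈ V, f ⬝ᵥ H = 1 → f ⬝ᵥ d ≤ 0) :
    ∃ ε : ℝ, 0 < ε ∧ H + ε • d ∈ polarSet V := by
  have hev : ∀ᶠ ε : ℝ in nhdsWithin 0 (Set.Ioi 0), ∀ f ∈ V, f ⬝ᵥ (H + ε • d) ≤ 1 := by
    rw [Filter.eventually_all_finset]
    intro f hf
    simp only [dotProduct_add, dotProduct_smul, smul_eq_mul]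
    rcases (hH f hf).lt_or_eq with hlt | heq
    · have hc : Continuous fun ε : ℝ => f ⬝ᵥ H + ε * f ⬝ᵥ d := by fun_prop
      have ht := (hc.tendsto 0).mono_left (nhdsWithin_le_nhds (s := Set.Ioi 0))
      rw [zero_mul, add_zero] at ht
      filter_upwards [ht.eventually (gt_mem_nhds hlt)] with ε hε using hε.le
    · filter_upwards [self_mem_nhdsWithin] with ε hε
      have := mul_nonpos_of_nonneg_of_nonpos (le_of_lt hε) (hd f hf heq)
      linarith
  obtain ⟨ε, h, hε⟩ := (hev.and self_mem_nhdsWithin).exists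
  exact ⟨ε, hε, h⟩

/-- A maximiser of a linear form over the polar can be chosen to be a vertex, that is with
active points spanning the whole space. -/
lemma exists_polar_vertex {n : ℕ} {V : Finset (Fin n → ℝ)}
    (h0 : (0 : Fin n → ℝ) ∈ interior (convexHull ℝ (V : Set (Fin n → ℝ)))) (p : Fin n → ℝ) :
    ∃ H ∈ polarSet V, (∀ H' ∈ polarSet V, p ⬝ᵥ H' ≤ p ⬝ᵥ H) ∧
      Submodule.span ℝ {f | f ∈ V ∧ f ⬝ᵥ H = 1} = ⊤ := by
  have hK := isCompact_polarSet h0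
  have hcp : Continuous fun H : Fin n → ℝ => p ⬝ᵥ H :=
    Continuous.dotProduct continuous_const continuous_id
  obtain ⟨H₀, hH₀, hmax₀⟩ := hK.exists_isMaxOn ⟨0, fun f _ => by simp⟩ hcp.continuousOn
  let M : Set (Fin n → ℝ) := polarSet V ∩ {H | p ⬝ᵥ H₀ ≤ p ⬝ᵥ H}
  have hM : IsCompact M := hK.inter_right (isClosed_le continuous_const hcp)
  obtain ⟨H, hHM, hext⟩ := hM.extremePoints_nonempty ⟨H₀, hH₀, le_refl (p ⬝ᵥ H₀)⟩
  have hmax : ∀ H' ∈ polarSet V, p ⬝ᵥ H' ≤ p ⬝ᵥ H := fun H' h' => (hmax₀ h').trans hHM.2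
  refine ⟨H, hHM.1, hmax, ?_⟩
  by_contra hspan
  obtain ⟨φ, hφ, hle⟩ := Submodule.exists_le_ker_of_lt_top _ (lt_top_iff_ne_top.2 hspan)
  set d : Fin n → ℝ := fun i => φ (Pi.single i 1) with hd
  have hφd : ∀ x, φ x = x ⬝ᵥ d := by
    intro x
    rw [LinearMap.pi_apply_eq_sum_univ φ x]
    simp only [dotProduct, hd, smul_eq_mul]
    refine Finset.sum_congr rfl fun i _ => ?_
    congr 2
    ext j
    simp [Pi.single_apply, eq_comm]
  have hact : ∀ f ∈ V, f ⬝ᵥ H = 1 → f ⬝ᵥ d = 0 := fun f hf h1 => by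
    rw [← hφd]; exact hle (Submodule.subset_span ⟨hf, h1⟩)
  obtain ⟨ε₁, hε₁, h₁⟩ := exists_pos_add_smul_mem_polarSet hHM.1 (d := d)
    fun f hf h => (hact f hf h).le
  obtain ⟨ε₂, hε₂, h₂⟩ := exists_pos_add_smul_mem_polarSet hHM.1 (d := -d)
    fun f hf h => by rw [dotProduct_neg, hact f hf h, neg_zero]
  have e₁ := hmax _ h₁
  have e₂ := hmax _ h₂
  simp only [dotProduct_add, dotProduct_smul, dotProduct_neg, smul_eq_mul] at e₁ e₂
  have hpd : p ⬝ᵥ d = 0 := by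
    apply le_antisymm <;> nlinarith
  have m₁ : H + ε₁ • d ∈ M := ⟨h₁, by
    simpa [dotProduct_add, dotProduct_smul, hpd] using hHM.2⟩
  have m₂ : H + ε₂ • (-d) ∈ M := ⟨h₂, by
    simpa [dotProduct_add, dotProduct_smul, hpd] using hHM.2⟩
  have hs : 0 < ε₁ + ε₂ := add_pos hε₁ hε₂
  have := hext m₁ m₂ ⟨ε₂ / (ε₁ + ε₂), ε₁ / (ε₁ + ε₂), by positivity, by positivity,
    by field_simp; ring, by ext i; simp; field_simp; ring⟩
  have hd0 : d = 0 := by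
    have : ε₁ • d = 0 := by simpa using this
    exact (smul_eq_zero.1 this).resolve_left hε₁.ne'
  exact hφ (LinearMap.ext fun x => by rw [hφd, hd0]; simp)

lemma isFacetOf_of_span_eq_top {n : ℕ} (hn : 0 < n) {V : Finset (Fin n → ℝ)} {H : Fin n → ℝ}
    (hH : H ∈ polarSet V) (hspan : Submodule.span ℝ {f | f ∈ V ∧ f ⬝ᵥ H = 1} = ⊤) :
    IsFacetOf {x | x ∈ convexHull ℝ (V : Set (Fin n → ℝ)) ∧ x ⬝ᵥ H = 1}
      (convexHull ℝ (V : Set (Fin n → ℝ))) := by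
  have : Nonempty (Fin n) := ⟨⟨0, hn⟩⟩
  obtain ⟨f₀, hf₀⟩ : {f | f ∈ V ∧ f ⬝ᵥ H = 1}.Nonempty := by
    by_contra hne
    rw [Set.not_nonempty_iff_eq_empty] at hne
    rw [hne, Submodule.span_empty] at hspan
    exact bot_ne_top hspan
  set F := {x | x ∈ convexHull ℝ (V : Set (Fin n → ℝ)) ∧ x ⬝ᵥ H = 1} with hF
  have hsub : {f | f ∈ V ∧ f ⬝ᵥ H = 1} ⊆ F := fun f hf => ⟨subset_convexHull ℝ _ hf.1, hf.2⟩
  refine ⟨fun _ => ⟨LinearMap.toContinuousLinearMap (dotRight H), ?_⟩, ?_⟩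
  · ext x
    simp only [hF, Set.mem_ofPred_eq, LinearMap.coe_toContinuousLinearMap', dotRight_apply]
    refine and_congr_right fun hx => ⟨fun h y hy => ?_, fun h => ?_⟩
    · rw [h]; exact dotProduct_le_one_of_mem_convexHull hH hy
    · refine le_antisymm (dotProduct_le_one_of_mem_convexHull hH hx) ?_
      rw [← hf₀.2]; exact h f₀ (hsub hf₀).1
  · have hker : vectorSpan ℝ F ≤ LinearMap.ker (dotRight H) := by
      rw [vectorSpan_def, Submodule.span_le]
      rintro _ ⟨x, hx, y, hy, rfl⟩
      simp [sub_dotProduct, hx.2, hy.2]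
    have hlt : Module.finrank ℝ (vectorSpan ℝ F) < n := by
      have h := Submodule.finrank_lt (s := vectorSpan ℝ F) fun htop => by
        rw [htop] at hker
        have : f₀ ⬝ᵥ H = 0 := hker (Submodule.mem_top (x := f₀))
        rw [hf₀.2] at this
        exact one_ne_zero this
      simpa using h
    have htop : vectorSpan ℝ F ⊔ Submodule.span ℝ {f₀} = ⊤ := by
      rw [eq_top_iff, ← hspan, Submodule.span_le]
      intro f hf
      rw [← sub_add_cancel f f₀]
      exact Submodule.add_mem_sup (vsub_mem_vectorSpan ℝ (hsub hf) (hsub hf₀))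
        (Submodule.mem_span_singleton_self f₀)
    have hle := Submodule.finrank_add_le_finrank_add_finrank (vectorSpan ℝ F)
      (Submodule.span ℝ {f₀})
    rw [htop, finrank_top] at hle
    have h1 := finrank_span_le_card (R := ℝ) ({f₀} : Set (Fin n → ℝ))
    simp at hle h1
    omega

/-- Inverting a matrix with integer entries and determinant `±1`. -/
lemma exists_int_solution {n : ℕ} (b : Fin n → Fin n → ℝ) (hb : ∀ i, IsLatticePoint (b i))
    (hdet : |(Matrix.of b).det| = 1) {H : Fin n → ℝ} (hH : ∀ i, b i ⬝ᵥ H = 1) :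
    IsLatticePoint H := by
  choose B hB using hb
  have hBb : (Matrix.of B).map (Int.castRingHom ℝ) = Matrix.of b := by
    ext i j; simp [hB]
  have hdetB : IsUnit (Matrix.of B).det := by
    rw [← hBb, ← RingHom.mapMatrix_apply, ← RingHom.map_det] at hdet
    rw [Int.isUnit_iff_abs_eq]
    rw [eq_intCast] at hdet
    exact_mod_cast hdet
  have hH' : Matrix.of b *ᵥ H = fun _ => 1 := funext hH
  have hinv : ((Matrix.of B)⁻¹).map (Int.castRingHom ℝ) * Matrix.of b = 1 := by
    rw [← hBb, ← Matrix.map_mul, Matrix.nonsing_inv_mul _ hdetB]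
    simp
  have hsol : H = ((Matrix.of B)⁻¹).map (Int.castRingHom ℝ) *ᵥ fun _ => 1 := by
    rw [← hH', Matrix.mulVec_mulVec, hinv, Matrix.one_mulVec]
  intro i
  refine ⟨∑ j, (Matrix.of B)⁻¹ i j, ?_⟩
  rw [hsol]
  simp [Matrix.mulVec, dotProduct]

lemma IsLatticePoint.dotProduct {n : ℕ} {x y : Fin n → ℝ} (hx : IsLatticePoint x)
    (hy : IsLatticePoint y) : ∃ m : ℤ, x ⬝ᵥ y = m := by
  choose X hX using hx
  choose Y hY using hy
  exact ⟨∑ i, X i * Y i, by simp [_root_.dotProduct, hX, hY]⟩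

/-- Every point `p` lies in the cone over a facet of a smooth Fano polytope. The facet is described
by the integral functional equal to `1` on it, and its vertices have dual functionals. -/
lemma IsSmoothFano.exists_facet_functional {n : ℕ} (hn : 0 < n) {Q : Set (Fin n → ℝ)}
    (hQ : IsSmoothFano Q) {V : Finset (Fin n → ℝ)} (hV : (V : Set (Fin n → ℝ)) = vertexSet Q)
    (p : Fin n → ℝ) :
    ∃ φ : (Fin n → ℝ) →ₗ[ℝ] ℝ, (∀ f ∈ V, φ f ≤ 1) ∧ (∀ f ∈ V, ∃ m : ℤ, φ f = m) ∧
      (∃ c : (Fin n → ℝ) → ℝ, (∀ f, 0 ≤ c f) ∧ (∀ f, c f ≠ 0 → φ f = 1) ∧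
        ∑ f ∈ V, c f • f = p) ∧
      (∀ f ∈ V, φ f = 1 → ∃ D : (Fin n → ℝ) →ₗ[ℝ] ℝ, D f = 1 ∧
        ∀ f' ∈ V, f' ≠ f → φ f' = 1 → D f' = 0) := by
  obtain ⟨hlat, h0, hfacet⟩ := hQ
  have hQV : convexHull ℝ (V : Set (Fin n → ℝ)) = Q := by rw [hV, convexHull_vertexSet hlat]
  rw [← hQV] at h0
  obtain ⟨H, hH, hmax, hspan⟩ := exists_polar_vertex h0 p
  have hF := isFacetOf_of_span_eq_top hn hH hspan
  rw [hQV] at hF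
  obtain ⟨b, hinj, hrange, hblat, hdet⟩ := hfacet _ hF
  have hb : ∀ f, (f ∈ V ∧ f ⬝ᵥ H = 1) ↔ ∃ i, b i = f := by
    intro f
    have : f ∈ vertexSet Q ∩ {x | x ∈ Q ∧ x ⬝ᵥ H = 1} ↔ f ∈ V ∧ f ⬝ᵥ H = 1 := by
      rw [← hV]
      refine ⟨fun h => ⟨h.1, h.2.2⟩, fun h => ⟨h.1, ?_, h.2⟩⟩
      rw [← hQV]; exact subset_convexHull ℝ _ h.1
    rw [← this, ← hrange, Set.mem_range]
  have hbV : ∀ i, b i ∈ V := fun i => ((hb _).2 ⟨i, rfl⟩).1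
  have hb1 : ∀ i, b i ⬝ᵥ H = 1 := fun i => ((hb _).2 ⟨i, rfl⟩).2
  have hunit : IsUnit (Matrix.of b).det := by
    rw [isUnit_iff_ne_zero]
    intro h; rw [h] at hdet; simp at hdet
  let e : Fin n → Fin n → ℝ := fun i => (Matrix.of b)⁻¹ *ᵥ Pi.single i 1
  have hbe : ∀ i j, b i ⬝ᵥ e j = if i = j then 1 else 0 := by
    intro i j
    have h : (Matrix.of b *ᵥ e j) i = (Pi.single j 1 : Fin n → ℝ) i := by
      simp only [e, Matrix.mulVec_mulVec, Matrix.mul_nonsing_inv _ hunit, Matrix.one_mulVec]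
    rw [Pi.single_apply] at h
    exact h
  have hp : ∑ i, (p ⬝ᵥ e i) • b i = p := by
    have h1 : (p ᵥ* (Matrix.of b)⁻¹) ᵥ* Matrix.of b = p := by
      rw [Matrix.vecMul_vecMul, Matrix.nonsing_inv_mul _ hunit, Matrix.vecMul_one]
    have h2 : ∀ i, p ⬝ᵥ e i = (p ᵥ* (Matrix.of b)⁻¹) i := by
      intro i
      simp only [e, Matrix.dotProduct_mulVec, dotProduct_single, mul_one]
    conv_rhs => rw [← h1]
    simp_rw [h2]
    ext j
    simp [Matrix.vecMul, dotProduct, Finset.sum_apply]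
  have hnonneg : ∀ i, 0 ≤ p ⬝ᵥ e i := by
    intro i
    obtain ⟨ε, hε, hmem⟩ := exists_pos_add_smul_mem_polarSet hH (d := -e i) fun f hf h1 => by
      obtain ⟨j, rfl⟩ := (hb f).1 ⟨hf, h1⟩
      rw [dotProduct_neg, hbe]
      split_ifs <;> simp
    have := hmax _ hmem
    simp only [dotProduct_add, dotProduct_smul, dotProduct_neg, smul_eq_mul] at this
    nlinarith
  refine ⟨dotRight H, hH, fun f hf => ?_, ⟨fun f => ∑ i, if b i = f then p ⬝ᵥ e i else 0,
    fun f => ?_, fun f hf => ?_, ?_⟩, fun f hf h1 => ?_⟩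
  · exact (isLatticePoint_of_mem_vertexSet hlat (hV ▸ hf)).dotProduct
      (exists_int_solution b hblat hdet hb1)
  · exact Finset.sum_nonneg fun i _ => by split_ifs <;> simp [hnonneg]
  · obtain ⟨i, -, hi⟩ := Finset.exists_ne_zero_of_sum_ne_zero hf
    have : b i = f := by by_contra hne; simp [hne] at hi
    rw [← this]; exact hb1 i
  · simp_rw [Finset.sum_smul]
    rw [Finset.sum_comm]
    conv_rhs => rw [← hp]
    refine Finset.sum_congr rfl fun i _ => ?_
    rw [Finset.sum_eq_single (b i)]
    · simp
    · intro f _ hne; simp [hne.symm]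
    · intro h; exact absurd (hbV i) h
  · obtain ⟨i, rfl⟩ := (hb f).1 ⟨hf, h1⟩
    refine ⟨dotRight (e i), by simp [hbe], fun f' hf' hne h1' => ?_⟩
    obtain ⟨j, rfl⟩ := (hb f').1 ⟨hf', h1'⟩
    rw [dotRight_apply, hbe, if_neg]
    rintro rfl; exact hne rfl

end ConvexGeometry

namespace PG

/-! ## Linear relations between the vertices of `P(a, b, k, l, α)` -/

/-- The family `y_1, …, y_b, u_1, …, u_b`. -/
def X (a b k : ℕ) (l : Fin k → ℕ) : Fin b ⊕ Fin b → Fin (dim a b k l) → ℝ :=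
  Sum.elim (y a b k l) (u a b k l)

/-- The multiplicity of `σ` among `α_{1,j}, …, α_{l_j,j}`. -/
def mult {b k : ℕ} {l : Fin k → ℕ} (α : (j : Fin k) → Fin (l j) → (Fin b ⊕ Fin b)) (j : Fin k)
    (σ : Fin b ⊕ Fin b) : ℕ :=
  (Finset.univ.filter fun i => α j i = σ).card

lemma sum_ite_eq_add (m c q : ℕ) (g : Fin m → ℝ) :
    (∑ j : Fin m, if q = c + j.val then g j else 0) =
      if h : c ≤ q ∧ q < c + m then g ⟨q - c, by omega⟩ else 0 := by
  split_ifs with h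
  · rw [Finset.sum_eq_single ⟨q - c, by omega⟩]
    · rw [if_pos (by simp only; omega)]
    · intro j _ hj
      rw [if_neg]
      rintro rfl
      exact hj (Fin.ext (by simp))
    · simp
  · refine Finset.sum_eq_zero fun j _ => if_neg ?_
    have := j.isLt
    omega

lemma sum_comp_eq_sum_mult {b k : ℕ} {l : Fin k → ℕ}
    (α : (j : Fin k) → Fin (l j) → (Fin b ⊕ Fin b)) (j : Fin k) (η : Fin b ⊕ Fin b → ℝ) :
    ∑ i, η (α j i) = ∑ σ, (mult α j σ : ℝ) * η σ := by
  rw [← Finset.sum_fiberwise Finset.univ (α j) (fun i => η (α j i))]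
  refine Finset.sum_congr rfl fun σ _ => ?_
  rw [Finset.sum_congr rfl (g := fun _ => η σ) fun i hi => by rw [(Finset.mem_filter.1 hi).2]]
  simp [mult]

lemma sum_mult {b k : ℕ} {l : Fin k → ℕ}
    (α : (j : Fin k) → Fin (l j) → (Fin b ⊕ Fin b)) (j : Fin k) :
    ∑ σ, (mult α j σ : ℝ) = l j := by
  have := sum_comp_eq_sum_mult α j fun _ => 1
  simpa using this.symm

section Coordinates

variable (a b k : ℕ) (l : Fin k → ℕ)

lemma sum_v_apply (g : Fin (a + 1) → ℝ) (q : Fin (dim (a + 1) (b + 1) k l)) :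
    ∑ i, g i * v (a + 1) (b + 1) k l i q =
      if h : q.val < a then g ⟨q, by omega⟩ - g (Fin.last a)
      else if q.val < a + 2 * b + 1 then - g (Fin.last a)
      else if q.val = a + 2 * b + 1 then (a + b + 1) * g (Fin.last a) else 0 := by
  have h1 := sum_ite_eq_add a 0 q fun i => g i.castSucc
  rw [Fin.sum_univ_castSucc]
  have h2 : ∀ i : Fin a, g i.castSucc * v (a + 1) (b + 1) k l i.castSucc q =
      if q.val = 0 + i.val then g i.castSucc else 0 := by
    intro i
    simp [v]
  simp_rw [h2, h1]
  simp only [v, Fin.val_last]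
  rw [if_neg (by omega)]
  split_ifs <;> first | omega | (simp; try ring)

lemma sum_y_apply (g : Fin (b + 1) → ℝ) (q : Fin (dim (a + 1) (b + 1) k l)) :
    ∑ i, g i * y (a + 1) (b + 1) k l i q =
      if h : a ≤ q.val ∧ q.val < a + b then g ⟨q - a, by omega⟩
      else if a + b ≤ q.val ∧ q.val ≤ a + 2 * b then g (Fin.last b) else 0 := by
  have h1 := sum_ite_eq_add b a q fun i => g i.castSucc
  rw [Fin.sum_univ_castSucc]
  have h2 : ∀ i : Fin b, g i.castSucc * y (a + 1) (b + 1) k l i.castSucc q =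
      if q.val = a + i.val then g i.castSucc else 0 := by
    intro i
    simp [y]
  simp_rw [h2, h1]
  simp only [y, Fin.val_last]
  rw [if_neg (by omega)]
  split_ifs <;> first | omega | (simp; try ring)

lemma sum_u_apply (g : Fin (b + 1) → ℝ) (q : Fin (dim (a + 1) (b + 1) k l)) :
    ∑ i, g i * u (a + 1) (b + 1) k l i q =
      if h : a + b + 1 ≤ q.val ∧ q.val < a + b + 1 + b then g ⟨q - (a + b + 1), by omega⟩
      else if a ≤ q.val ∧ q.val ≤ a + b then g (Fin.last b)
      else if q.val = a + 2 * b + 1 then - g (Fin.last b) else 0 := by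
  have h1 := sum_ite_eq_add b (a + b + 1) q fun i => g i.castSucc
  rw [Fin.sum_univ_castSucc]
  have h2 : ∀ i : Fin b, g i.castSucc * u (a + 1) (b + 1) k l i.castSucc q =
      if q.val = a + b + 1 + i.val then g i.castSucc else 0 := by
    intro i
    have : a + 1 + (b + 1) - 1 = a + b + 1 := by omega
    simp [u, this]
  simp_rw [h2, h1]
  simp only [u, Fin.val_last]
  rw [if_neg (by omega)]
  split_ifs <;> first | omega | (simp; try ring)

end Coordinates

lemma z_add_t (a b k : ℕ) (l : Fin k → ℕ) : z a b k l + t a b k l = 0 := by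
  ext q
  simp only [z, t, Pi.add_apply, Pi.zero_apply]
  split_ifs <;> simp

lemma sum_u_add_t {a b : ℕ} (k : ℕ) (l : Fin k → ℕ) (ha : 1 ≤ a) (hb : 1 ≤ b) :
    ∑ i, u a b k l i + t a b k l = ∑ i, y a b k l i := by
  obtain ⟨a, rfl⟩ := Nat.exists_eq_add_of_le' ha
  obtain ⟨b, rfl⟩ := Nat.exists_eq_add_of_le' hb
  ext q
  have h1 := sum_u_apply a b k l (fun _ => 1) q
  have h2 := sum_y_apply a b k l (fun _ => 1) q
  simp only [one_mul] at h1 h2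
  simp only [Pi.add_apply, Finset.sum_apply, h1, h2, t]
  split_ifs <;> first | omega | simp

lemma sum_v_add_sum_y {a b : ℕ} (k : ℕ) (l : Fin k → ℕ) (ha : 1 ≤ a) (hb : 1 ≤ b) :
    ∑ i, v a b k l i + ∑ i, y a b k l i = ((a : ℝ) + b - 1) • t a b k l := by
  obtain ⟨a, rfl⟩ := Nat.exists_eq_add_of_le' ha
  obtain ⟨b, rfl⟩ := Nat.exists_eq_add_of_le' hb
  ext q
  have h1 := sum_v_apply a b k l (fun _ => 1) q
  have h2 := sum_y_apply a b k l (fun _ => 1) q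
  simp only [one_mul] at h1 h2
  simp only [Pi.add_apply, Finset.sum_apply, h1, h2, t, Pi.smul_apply, smul_eq_mul]
  split_ifs <;> first | omega | (push_cast; ring)

section Blocks

variable (a b k : ℕ) (l : Fin k → ℕ) (α : (j : Fin k) → Fin (l j) → (Fin b ⊕ Fin b))

lemma sum_w_smul (j : Fin k) (g : Fin (l j + 1) → ℝ) (q : Fin (dim a b k l)) :
    ∑ i, g i * w a b k l α j i q =
      g (Fin.last _) * ∑ i, A a b k l α j i q +
      if h : a + 2 * b - 1 + Lprev k l j ≤ q.val ∧ q.val < a + 2 * b - 1 + Lprev k l j + l j then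
        g ⟨q - (a + 2 * b - 1 + Lprev k l j), by omega⟩ - g (Fin.last _) else 0 := by
  have h1 := sum_ite_eq_add (l j) (a + 2 * b - 1 + Lprev k l j) q fun i => g i.castSucc
  rw [Fin.sum_univ_castSucc]
  have h2 : ∀ i : Fin (l j), g i.castSucc * w a b k l α j i.castSucc q =
      if q.val = a + 2 * b - 1 + Lprev k l j + i.val then g i.castSucc else 0 := by
    intro i
    simp [w]
  simp_rw [h2, h1]
  simp only [w, Fin.val_last, lt_irrefl, if_false]
  split_ifs
  · simp; ring
  · simp

lemma sum_w (j : Fin k) : ∑ i, w a b k l α j i = ∑ i, X a b k l (α j i) := by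
  ext q
  have h := sum_w_smul a b k l α j (fun _ => 1) q
  simp only [one_mul, sub_self, dite_eq_ite, ite_self, add_zero] at h
  simp only [Finset.sum_apply, h]
  rfl

lemma Lprev_add_le {j j' : Fin k} (h : j < j') : Lprev k l j + l j ≤ Lprev k l j' := by
  have h1 : j ∉ Finset.univ.filter (fun i : Fin k => i < j) := by simp
  unfold Lprev
  rw [add_comm, ← Finset.sum_insert h1]
  refine Finset.sum_le_sum_of_subset fun i hi => ?_
  simp only [Finset.mem_insert, Finset.mem_filter, Finset.mem_univ, true_and] at hi ⊢
  rcases hi with rfl | hi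
  · exact h
  · exact hi.trans h

lemma Lprev_add_le_sum (j : Fin k) : Lprev k l j + l j ≤ ∑ i, l i := by
  have h1 : j ∉ Finset.univ.filter (fun i : Fin k => i < j) := by simp
  unfold Lprev
  rw [add_comm, ← Finset.sum_insert h1]
  exact Finset.sum_le_sum_of_subset (Finset.subset_univ _)

end Blocks

/-- The contribution of the points `w_{i,j}` to the coordinate `q` of a relation, apart from the one
coming from the `α_{i,j}`. -/
def blockPart (a b k : ℕ) (l : Fin k → ℕ) (gw : (j : Fin k) → Fin (l j + 1) → ℝ) (q : ℕ) : ℝ :=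
  ∑ j, if h : a + 2 * b - 1 + Lprev k l j ≤ q ∧ q < a + 2 * b - 1 + Lprev k l j + l j then
    gw j ⟨q - (a + 2 * b - 1 + Lprev k l j), by omega⟩ - gw j (Fin.last _) else 0

lemma blockPart_eq_zero {a b k : ℕ} {l : Fin k → ℕ} (gw : (j : Fin k) → Fin (l j + 1) → ℝ) {q : ℕ}
    (hq : q < a + 2 * b - 1) : blockPart a b k l gw q = 0 :=
  Finset.sum_eq_zero fun _ _ => dif_neg (by omega)

lemma blockPart_apply {a b k : ℕ} {l : Fin k → ℕ} (gw : (j : Fin k) → Fin (l j + 1) → ℝ)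
    (j : Fin k) (i : Fin (l j)) :
    blockPart a b k l gw (a + 2 * b - 1 + Lprev k l j + i) =
      gw j i.castSucc - gw j (Fin.last _) := by
  have hlt := i.isLt
  unfold blockPart
  rw [Finset.sum_eq_single j]
  · rw [dif_pos (by omega)]
    congr 2
    exact Fin.ext (by simp)
  · intro j' _ hne
    refine dif_neg ?_
    rcases lt_or_gt_of_ne hne with h | h
    · have := Lprev_add_le k l h
      omega
    · have := Lprev_add_le k l h
      omega
  · simp

lemma relation_coord {a b k : ℕ} {l : Fin k → ℕ} {α : (j : Fin k) → Fin (l j) → (Fin b ⊕ Fin b)}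
    {gv : Fin a → ℝ} {gX : Fin b ⊕ Fin b → ℝ} {gz gt : ℝ} {gw : (j : Fin k) → Fin (l j + 1) → ℝ}
    (h : ∑ i, gv i • v a b k l i + ∑ σ, gX σ • X a b k l σ + gz • z a b k l + gt • t a b k l +
      ∑ j, ∑ i, gw j i • w a b k l α j i = 0)
    {G : Fin b ⊕ Fin b → ℝ} (hG : ∀ σ, G σ = gX σ + ∑ j, gw j (Fin.last _) * mult α j σ)
    (q : Fin (dim a b k l)) :
    ∑ i, gv i * v a b k l i q + ∑ i, G (.inl i) * y a b k l i q +
      ∑ i, G (.inr i) * u a b k l i q + gz * z a b k l q + gt * t a b k l q +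
      blockPart a b k l gw q = 0 := by
  have hA : ∑ j, gw j (Fin.last _) * ∑ i, A a b k l α j i q =
      ∑ σ, (∑ j, gw j (Fin.last _) * mult α j σ) * X a b k l σ q := by
    have : ∀ j, ∑ i, A a b k l α j i q = ∑ σ, (mult α j σ : ℝ) * X a b k l σ q := fun j =>
      sum_comp_eq_sum_mult α j fun σ => X a b k l σ q
    simp_rw [this, Finset.mul_sum, Finset.sum_mul]
    rw [Finset.sum_comm]
    simp_rw [mul_assoc]
  have hq := congrFun h q
  simp only [Pi.add_apply, Finset.sum_apply, Pi.smul_apply, smul_eq_mul, Pi.zero_apply, sum_w_smul,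
    Finset.sum_add_distrib] at hq
  rw [← hq, hA]
  simp only [hG, Fintype.sum_sum_type, X, Sum.elim_inl, Sum.elim_inr, add_mul,
    Finset.sum_add_distrib, blockPart]
  abel

/-- The relation space: coefficients of a linear relation between the labelled points are determined
by three numbers and one number per block. -/
lemma relation_coeffs {a b k : ℕ} {l : Fin k → ℕ} (ha : 1 ≤ a) (hb : 1 ≤ b)
    {α : (j : Fin k) → Fin (l j) → (Fin b ⊕ Fin b)}
    {gv : Fin a → ℝ} {gX : Fin b ⊕ Fin b → ℝ} {gz gt : ℝ} {gw : (j : Fin k) → Fin (l j + 1) → ℝ}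
    (h : ∑ i, gv i • v a b k l i + ∑ σ, gX σ • X a b k l σ + gz • z a b k l + gt • t a b k l +
      ∑ j, ∑ i, gw j i • w a b k l α j i = 0) :
    ∃ (m n : ℝ) (p : Fin k → ℝ), (∀ i, gv i = m) ∧ (∀ j i, gw j i = p j) ∧
      (∀ q, gX (.inl q) = m - n - ∑ j, p j * mult α j (.inl q)) ∧
      (∀ q, gX (.inr q) = n - ∑ j, p j * mult α j (.inr q)) ∧
      gt = n + gz - (a + b - 1) * m := by
  obtain ⟨a, rfl⟩ := Nat.exists_eq_add_of_le' ha
  obtain ⟨b, rfl⟩ := Nat.exists_eq_add_of_le' hb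
  obtain ⟨G, hG⟩ : ∃ G : Fin (b + 1) ⊕ Fin (b + 1) → ℝ,
    ∀ σ, G σ = gX σ + ∑ j, gw j (Fin.last _) * mult α j σ := ⟨_, fun _ => rfl⟩
  have hcoord := relation_coord h hG
  clear h
  simp only [sum_v_apply, sum_y_apply, sum_u_apply, z, t] at hcoord
  have hdim : dim (a + 1) (b + 1) k l = a + 2 * b + 2 + ∑ j, l j := by
    unfold dim; omega
  have hGy : ∀ q, G (.inl q) = gv (Fin.last a) - G (.inr (Fin.last b)) := by
    intro q
    induction q using Fin.lastCases with
    | last =>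
      have h1 := hcoord ⟨a + b, by omega⟩
      rw [blockPart_eq_zero _ (by simp only; omega)] at h1
      split_ifs at h1 <;> first | omega | linarith
    | cast q =>
      have h1 := hcoord ⟨a + q, by omega⟩
      rw [blockPart_eq_zero _ (by simp only; omega)] at h1
      have h2 : (⟨a + q.val - a, by omega⟩ : Fin (b + 1)) = q.castSucc := Fin.ext (by simp)
      have := q.isLt
      simp only [h2] at h1
      split_ifs at h1 <;> first | omega | linarith
  have hGu : ∀ q, G (.inr q) = G (.inr (Fin.last b)) := by
    intro q
    induction q using Fin.lastCases with
    | last => rfl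
    | cast q =>
      have h1 := hcoord ⟨a + b + 1 + q, by omega⟩
      rw [blockPart_eq_zero _ (by simp only; omega)] at h1
      have h2 : (⟨a + b + 1 + q.val - (a + b + 1), by omega⟩ : Fin (b + 1)) = q.castSucc :=
        Fin.ext (by simp)
      have := q.isLt
      have h3 := hGy (Fin.last b)
      simp only [h2] at h1
      split_ifs at h1 <;> first | omega | linarith
  refine ⟨gv (Fin.last a), G (.inr (Fin.last b)), fun j => gw j (Fin.last _), fun i => ?_,
    fun j i => ?_, fun q => ?_, fun q => ?_, ?_⟩
  · induction i using Fin.lastCases with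
    | last => rfl
    | cast i =>
      have h1 := hcoord ⟨i, by omega⟩
      rw [blockPart_eq_zero _ (by simp only; omega)] at h1
      have h2 : (⟨i.val, by omega⟩ : Fin (a + 1)) = i.castSucc := rfl
      have := i.isLt
      simp only [h2] at h1
      split_ifs at h1 <;> first | omega | linarith
  · induction i using Fin.lastCases with
    | last => rfl
    | cast i =>
      have hlt := i.isLt
      have hle := Lprev_add_le_sum k l j
      have h1 := hcoord ⟨a + 1 + 2 * (b + 1) - 1 + Lprev k l j + i, by omega⟩
      rw [blockPart_apply, dif_neg (by simp only; omega), if_neg (by simp only; omega),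
        if_neg (by simp only; omega), dif_neg (by simp only; omega), if_neg (by simp only; omega),
        dif_neg (by simp only; omega), if_neg (by simp only; omega), if_neg (by simp only; omega),
        if_neg (by simp only; omega), if_neg (by simp only; omega)] at h1
      linarith
  · rw [← hGy q, hG]; ring
  · rw [← hGu q, hG]; ring
  · have h1 := hcoord ⟨a + 2 * b + 1, by omega⟩
    rw [blockPart_eq_zero _ (by simp only; omega)] at h1
    push_cast
    simp only at h1
    split_ifs at h1 <;> first | omega | linarith

end PG

section AlmostAllVertices

variable {n : ℕ} {Q : Set (Fin n → ℝ)} {ι : Type*} [Fintype ι] [DecidableEq ι]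
  {x : ι → Fin n → ℝ} {i₀ : ι}

/-- A set with one element less than `ι`, covered by a family indexed by `ι`, is parametrised
injectively by the complement of one index. -/
lemma exists_image_erase {β : Type*} [DecidableEq β] {V : Finset β} {x : ι → β}
    (hsub : (V : Set β) ⊆ Set.range x)
    (hcard : V.card + 1 = Fintype.card ι) :
    ∃ i₀ : ι, V = (Finset.univ.erase i₀).image x ∧
      Set.InjOn x ((Finset.univ.erase i₀ : Finset ι) : Set ι) := by
  choose s hs using fun f : V => hsub f.2
  have hsinj : Function.Injective s := fun f f' h => Subtype.ext (by rw [← hs f, ← hs f', h])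
  have hT : (Finset.univ.image s).card = V.card := by
    rw [Finset.card_image_of_injective _ hsinj, Finset.card_univ, Fintype.card_coe]
  have hc : (Finset.univ.image s)ᶜ.card = 1 := by
    rw [Finset.card_compl, hT]; omega
  obtain ⟨i₀, hi₀⟩ := Finset.card_eq_one.1 hc
  have hE : Finset.univ.erase i₀ = Finset.univ.image s := by
    rw [← compl_compl (Finset.univ.image s), hi₀]
    ext i; simp
  refine ⟨i₀, ?_, ?_⟩
  · rw [hE]
    ext f
    simp only [Finset.mem_image, Finset.mem_univ, true_and, exists_exists_eq_and, hs]
    exact ⟨fun hf => ⟨⟨f, hf⟩, rfl⟩, fun ⟨g, hg⟩ => hg ▸ g.2⟩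
  · rw [hE]
    intro i hi j hj hij
    simp only [Finset.coe_image, Finset.coe_univ, Set.image_univ, Set.mem_range] at hi hj
    obtain ⟨f, rfl⟩ := hi
    obtain ⟨f', rfl⟩ := hj
    rw [hs, hs] at hij
    rw [Subtype.ext hij]

/-- The vertices of `Q` are the distinct points `x i` with `i ≠ i₀`. -/
def ParametrizesVertices (Q : Set (Fin n → ℝ)) (x : ι → Fin n → ℝ) (i₀ : ι) : Prop :=
  (((Finset.univ.erase i₀).image x : Finset (Fin n → ℝ)) : Set (Fin n → ℝ)) = vertexSet Q ∧
    Set.InjOn x ((Finset.univ.erase i₀ : Finset ι) : Set ι)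

lemma ParametrizesVertices.sum_eq {E : Type*} [AddCommMonoid E] [Module ℝ E]
    (hx : ParametrizesVertices Q x i₀)
    (c : (Fin n → ℝ) → ℝ) (e : (Fin n → ℝ) → E) :
    ∑ i, (if i = i₀ then 0 else c (x i)) • e (x i) =
      ∑ f ∈ (Finset.univ.erase i₀).image x, c f • e f := by
  rw [Finset.sum_image hx.2, ← Finset.add_sum_erase _ _ (Finset.mem_univ i₀), if_pos rfl, zero_smul,
    zero_add]
  exact Finset.sum_congr rfl fun i hi => by rw [if_neg (Finset.ne_of_mem_erase hi)]

lemma ParametrizesVertices.exists_pos_relation (hx : ParametrizesVertices Q x i₀)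
    (hQ : IsSmoothFano Q) :
    ∃ g : ι → ℝ, g i₀ = 0 ∧ (∀ i ≠ i₀, 0 < g i) ∧ ∑ i, g i • x i = 0 := by
  obtain ⟨c, hc, hsum⟩ := _root_.exists_pos_relation ((Finset.univ.erase i₀).image x)
    (by rw [hx.1, convexHull_vertexSet hQ.1]; exact hQ.2.1)
  refine ⟨fun i => if i = i₀ then 0 else c (x i), if_pos rfl, fun i hi => ?_, ?_⟩
  · simpa [hi] using hc (x i)
  · rw [← hsum]
    exact hx.sum_eq c id

/-- For a set `S` of vertices of a smooth Fano polytope, either `S` lies in a facet, or `∑ S` is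
a nonnegative combination of vertices with smaller sum of coefficients; `g` is the resulting
relation. In both cases the functional defining the facet whose cone contains `∑ S` is given. -/
lemma ParametrizesVertices.exists_facet (hx : ParametrizesVertices Q x i₀) (hn : 0 < n)
    (hQ : IsSmoothFano Q) (S : Finset ι) (hS : i₀ ∉ S) :
    ∃ φ : (Fin n → ℝ) →ₗ[ℝ] ℝ, (∀ i ≠ i₀, φ (x i) ≤ 1) ∧ (∀ i ≠ i₀, ∃ m : ℤ, φ (x i) = m) ∧
      (∀ i ≠ i₀, φ (x i) = 1 → ∃ D : (Fin n → ℝ) →ₗ[ℝ] ℝ, D (x i) = 1 ∧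
        ∀ i' ≠ i₀, i' ≠ i → φ (x i') = 1 → D (x i') = 0) ∧
      ((∀ i ∈ S, φ (x i) = 1) ∨ ∃ g : ι → ℝ, g i₀ = 0 ∧ (∀ i ∈ S, g i ≤ 1) ∧
        (∀ i ∉ S, g i ≤ 0) ∧ 1 ≤ ∑ i, g i ∧ ∑ i, g i • x i = 0) := by
  have hmem : ∀ i ≠ i₀, x i ∈ (Finset.univ.erase i₀).image x := fun i hi =>
    Finset.mem_image_of_mem x (Finset.mem_erase.2 ⟨hi, Finset.mem_univ i⟩)
  obtain ⟨φ, hφ, hint, ⟨c, hc0, hc1, hcp⟩, hD⟩ :=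
    hQ.exists_facet_functional hn hx.1 (∑ i ∈ S, x i)
  refine ⟨φ, fun i hi => hφ _ (hmem i hi), fun i hi => hint _ (hmem i hi), fun i hi h1 => ?_, ?_⟩
  · obtain ⟨D, hD1, hD0⟩ := hD _ (hmem i hi) h1
    refine ⟨D, hD1, fun i' hi' hne h => hD0 _ (hmem i' hi') (fun he => hne ?_) h⟩
    exact hx.2 (by simpa using hi') (by simpa using hi) he
  · by_cases hall : ∀ i ∈ S, φ (x i) = 1
    · exact Or.inl hall
    push Not at hall
    obtain ⟨i₁, hi₁, hne⟩ := hall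
    have hS0 : ∀ i ∈ S, i ≠ i₀ := fun i hi h => hS (h ▸ hi)
    obtain ⟨m, hm⟩ := hint _ (hmem i₁ (hS0 i₁ hi₁))
    have hm0 : φ (x i₁) ≤ 0 := by
      have h1 := hφ _ (hmem i₁ (hS0 i₁ hi₁))
      rw [hm] at h1 hne ⊢
      have h2 : m < 1 := lt_of_le_of_ne (by exact_mod_cast h1) (by exact_mod_cast hne)
      exact_mod_cast Int.lt_add_one_iff.1 h2
    have hsumφ : ∑ i ∈ S, φ (x i) ≤ S.card - 1 := by
      rw [← Finset.add_sum_erase _ _ hi₁]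
      have h2 : ∑ i ∈ S.erase i₁, φ (x i) ≤ ∑ i ∈ S.erase i₁, 1 :=
        Finset.sum_le_sum fun i hi => hφ _ (hmem i (hS0 i (Finset.mem_of_mem_erase hi)))
      rw [Finset.sum_const, Finset.card_erase_of_mem hi₁, nsmul_one,
        Nat.cast_sub (Finset.card_pos.2 ⟨i₁, hi₁⟩)] at h2
      push_cast at h2
      linarith
    have hcφ : ∑ f ∈ (Finset.univ.erase i₀).image x, c f = ∑ i ∈ S, φ (x i) := by
      rw [← map_sum, ← hcp, map_sum]
      refine Finset.sum_congr rfl fun f _ => ?_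
      rw [map_smul, smul_eq_mul]
      by_cases hf : c f = 0
      · rw [hf, zero_mul]
      · rw [hc1 f hf, mul_one]
    have hg0 : ∀ i, 0 ≤ if i = i₀ then 0 else c (x i) := fun i => by
      split_ifs
      exacts [le_rfl, hc0 _]
    refine Or.inr ⟨fun i => (if i ∈ S then 1 else 0) - (if i = i₀ then 0 else c (x i)),
      by simp [hS], fun i hi => ?_, fun i hi => ?_, ?_, ?_⟩
    · have := hg0 i
      simp only [hi, if_true]
      linarith
    · have := hg0 i
      simp only [hi, if_false]
      linarith
    · have h1 := hx.sum_eq c (fun _ => (1 : ℝ))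
      simp only [smul_eq_mul, mul_one] at h1
      rw [Finset.sum_sub_distrib, h1, hcφ, Finset.sum_ite_mem, Finset.univ_inter, Finset.sum_const,
        nsmul_one]
      linarith
    · simp only [sub_smul, Finset.sum_sub_distrib, ite_smul (p := _ ∈ S), one_smul, zero_smul]
      rw [Finset.sum_ite_mem, Finset.univ_inter]
      have h1 := hx.sum_eq c id
      simp only [id] at h1
      rw [h1, hcp, sub_self]

end AlmostAllVertices

namespace PG

/-! ## Subpolytopes with one vertex less -/

/-- Labels for the points defining `P(a, b, k, l, α)`: in order those of the `v_i`, of the `y_q` and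
`u_q`, of `z` (`false`) and `t` (`true`), and of the `w_{i,j}`. -/
abbrev Label (a b k : ℕ) (l : Fin k → ℕ) : Type :=
  Fin a ⊕ (Fin b ⊕ Fin b) ⊕ Bool ⊕ (Σ j : Fin k, Fin (l j + 1))

/-- The labels of `y_1, …, y_b, u_1, …, u_b`. -/
abbrev lX {a b k : ℕ} {l : Fin k → ℕ} (σ : Fin b ⊕ Fin b) : Label a b k l := .inr (.inl σ)

/-- The label of `z`. -/
abbrev lz {a b k : ℕ} {l : Fin k → ℕ} : Label a b k l := .inr (.inr (.inl false))

/-- The label of `t`. -/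
abbrev lt {a b k : ℕ} {l : Fin k → ℕ} : Label a b k l := .inr (.inr (.inl true))

/-- The label of `w_{i,j}`. -/
abbrev lw {a b k : ℕ} {l : Fin k → ℕ} (j : Fin k) (i : Fin (l j + 1)) : Label a b k l :=
  .inr (.inr (.inr ⟨j, i⟩))

/-- The labelled point. -/
def point (a b k : ℕ) (l : Fin k → ℕ) (α : (j : Fin k) → Fin (l j) → (Fin b ⊕ Fin b)) :
    Label a b k l → Fin (dim a b k l) → ℝ :=
  Sum.elim (v a b k l) (Sum.elim (X a b k l) (Sum.elim
    (fun s => cond s (t a b k l) (z a b k l)) (fun ji => w a b k l α ji.1 ji.2)))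

variable {a b k : ℕ} {l : Fin k → ℕ} {α : (j : Fin k) → Fin (l j) → (Fin b ⊕ Fin b)}

lemma sum_label {E : Type*} [AddCommMonoid E] (f : Label a b k l → E) :
    ∑ i, f i = ∑ i, f (.inl i) + ∑ σ, f (lX σ) + f lz + f lt + ∑ j, ∑ i, f (lw j i) := by
  simp only [Fintype.sum_sum_type, Fintype.sum_sigma, Fintype.sum_bool]
  abel

lemma card_label (ha : 1 ≤ a) : Fintype.card (Label a b k l) = dim a b k l + k + 3 := by
  simp only [Fintype.card_sum, Fintype.card_fin, Fintype.card_bool, Fintype.card_sigma,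
    Finset.sum_add_distrib, Finset.sum_const, Finset.card_univ, smul_eq_mul, mul_one, dim]
  omega

lemma vertexSet_P_subset : vertexSet (P a b k l α) ⊆ Set.range (point a b k l α) := by
  refine extremePoints_convexHull_subset.trans ?_
  rintro f ((((⟨i, rfl⟩ | ⟨q, rfl⟩) | rfl | rfl) | ⟨q, rfl⟩) | hf)
  · exact ⟨.inl i, rfl⟩
  · exact ⟨lX (.inl q), rfl⟩
  · exact ⟨lz, rfl⟩
  · exact ⟨lt, rfl⟩
  · exact ⟨lX (.inr q), rfl⟩
  · obtain ⟨j, i, rfl⟩ := Set.mem_iUnion.1 hf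
    exact ⟨lw j i, rfl⟩

/-- `relation_coeffs` for labelled points, with the sum of all coefficients. -/
lemma point_relation_coeffs (ha : 1 ≤ a) (hb : 1 ≤ b) {g : Label a b k l → ℝ}
    (h : ∑ i, g i • point a b k l α i = 0) :
    ∃ (m n : ℝ) (p : Fin k → ℝ), (∀ i, g (.inl i) = m) ∧ (∀ j i, g (lw j i) = p j) ∧
      (∀ q, g (lX (.inl q)) = m - n - ∑ j, p j * mult α j (.inl q)) ∧
      (∀ q, g (lX (.inr q)) = n - ∑ j, p j * mult α j (.inr q)) ∧
      g lt = n + g lz - (a + b - 1) * m ∧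
      ∑ i, g i = m + n + 2 * g lz + ∑ j, p j := by
  rw [sum_label] at h
  obtain ⟨m, n, p, hv, hw, hy, hu, ht⟩ := relation_coeffs ha hb (gv := fun i => g (.inl i))
    (gX := fun σ => g (lX σ)) (gz := g lz) (gt := g lt) (gw := fun j i => g (lw j i)) h
  refine ⟨m, n, p, hv, hw, hy, hu, ht, ?_⟩
  have hs : ∑ q, ∑ j, p j * mult α j (.inl q) + ∑ q, ∑ j, p j * mult α j (.inr q) =
      ∑ j, p j * l j := by
    rw [← Fintype.sum_sum_type (fun σ => ∑ j, p j * mult α j σ), Finset.sum_comm]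
    simp_rw [← Finset.mul_sum, sum_mult]
  rw [sum_label, Fintype.sum_sum_type]
  simp only [hv, hw, hy, hu, ht, Finset.sum_sub_distrib, Finset.sum_const, Finset.card_univ,
    Fintype.card_fin, nsmul_eq_mul]
  push_cast
  have hp : ∑ j, ((l j : ℝ) + 1) * p j = ∑ j, p j * l j + ∑ j, p j := by
    rw [← Finset.sum_add_distrib]
    exact Finset.sum_congr rfl fun j _ => by ring
  rw [hp, ← hs]
  ring

lemma sum_mul_mult_nonpos {p : Fin k → ℝ} (hp : ∀ j, p j ≤ 0) (σ : Fin b ⊕ Fin b) :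
    ∑ j, p j * mult α j σ ≤ 0 :=
  Finset.sum_nonpos fun j _ => mul_nonpos_of_nonpos_of_nonneg (hp j) (Nat.cast_nonneg _)

/-- A relation vanishing on `t` and nonpositive on `z`, on some `u_q` and on the last points
`w_{l_j+1,j}` of all blocks has nonpositive sum of coefficients. -/
lemma degree_nonpos_of_removed_t (ha : 2 ≤ a) (hb : 1 ≤ b) {g : Label a b k l → ℝ}
    (h : ∑ i, g i • point a b k l α i = 0) (q₀ : Fin b) (hu : g (lX (.inr q₀)) ≤ 0)
    (hz : g lz ≤ 0) (hw : ∀ j, g (lw j (Fin.last _)) ≤ 0) (ht : g lt = 0) :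
    ∑ i, g i ≤ 0 := by
  obtain ⟨m, n, p, -, hwp, -, hun, htn, hdeg⟩ := point_relation_coeffs (by omega) hb h
  have hp : ∀ j, p j ≤ 0 := fun j => hwp j (Fin.last _) ▸ hw j
  have hn : n ≤ 0 := by
    have := sum_mul_mult_nonpos (α := α) hp (.inr q₀)
    rw [hun] at hu
    linarith
  have hab : (3 : ℝ) ≤ a + b := by exact_mod_cast (by omega : 3 ≤ a + b)
  have hm : m ≤ 0 := by
    by_contra hm
    push Not at hm
    nlinarith
  have := Finset.sum_nonpos fun j (_ : j ∈ Finset.univ) => hp j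
  linarith

/-- If `p` is nonpositive with sum zero, it vanishes, and so do the sums weighted by
multiplicities. -/
lemma sum_mul_mult_eq_zero {p : Fin k → ℝ} (hp : ∀ j, p j ≤ 0) (h : 0 ≤ ∑ j, p j)
    (σ : Fin b ⊕ Fin b) : ∑ j, p j * mult α j σ = 0 := by
  have h0 : ∑ j, p j = 0 := le_antisymm (Finset.sum_nonpos fun j _ => hp j) h
  rw [Finset.sum_eq_zero_iff_of_nonpos fun j _ => hp j] at h0
  exact Finset.sum_eq_zero fun j hj => by rw [h0 j hj, zero_mul]

/-- A relation vanishing on `y_q`, at most `1` on the `u_r` and nonpositive on `z`, the `v_i` and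
the `w_{i,j}` has sum of coefficients less than `1`. -/
lemma degree_lt_one_of_removed_y (ha : 2 ≤ a) (hb : 1 ≤ b) {g : Label a b k l → ℝ}
    (h : ∑ i, g i • point a b k l α i = 0) (q : Fin b) (hq : g (lX (.inl q)) = 0)
    (hv : ∀ i, g (.inl i) ≤ 0) (hu : ∀ r, g (lX (.inr r)) ≤ 1) (hz : g lz ≤ 0)
    (hw : ∀ j i, g (lw j i) ≤ 0) : ∑ i, g i < 1 := by
  obtain ⟨m, n, p, hvm, hwp, hyn, hun, -, hdeg⟩ := point_relation_coeffs (by omega) hb h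
  have hp : ∀ j, p j ≤ 0 := fun j => hwp j (Fin.last _) ▸ hw j _
  have hm : m ≤ 0 := hvm ⟨0, by omega⟩ ▸ hv _
  have hsq := sum_mul_mult_nonpos (α := α) hp (.inl q)
  have hsq' := sum_mul_mult_nonpos (α := α) hp (.inr q)
  have hps := Finset.sum_nonpos fun j (_ : j ∈ Finset.univ) => hp j
  have huq := hu q
  rw [hyn] at hq
  rw [hun] at huq
  by_contra hlt
  push Not at hlt
  have h0 := sum_mul_mult_eq_zero (α := α) hp (by linarith) (.inl q)
  linarith

/-- A relation vanishing on `u_q`, at most `1` on `z` and the `y_r` and nonpositive on `t`, the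
`v_i` and the `w_{i,j}` has sum of coefficients less than `1`. -/
lemma degree_lt_one_of_removed_u (ha : 2 ≤ a) (hb : 1 ≤ b) {g : Label a b k l → ℝ}
    (h : ∑ i, g i • point a b k l α i = 0) (q : Fin b) (hq : g (lX (.inr q)) = 0)
    (hv : ∀ i, g (.inl i) ≤ 0) (hy : ∀ r, g (lX (.inl r)) ≤ 1) (hz : g lz ≤ 1) (ht : g lt ≤ 0)
    (hw : ∀ j i, g (lw j i) ≤ 0) : ∑ i, g i < 1 := by
  obtain ⟨m, n, p, hvm, hwp, hyn, hun, htn, hdeg⟩ := point_relation_coeffs (by omega) hb h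
  have hp : ∀ j, p j ≤ 0 := fun j => hwp j (Fin.last _) ▸ hw j _
  have hm : m ≤ 0 := hvm ⟨0, by omega⟩ ▸ hv _
  have hsq := sum_mul_mult_nonpos (α := α) hp (.inl q)
  have hsq' := sum_mul_mult_nonpos (α := α) hp (.inr q)
  have hps := Finset.sum_nonpos fun j (_ : j ∈ Finset.univ) => hp j
  have hyq := hy q
  rw [hyn] at hyq
  rw [hun] at hq
  have hab : (3 : ℝ) ≤ a + b := by exact_mod_cast (by omega : 3 ≤ a + b)
  have hKm : (a + b - 1 : ℝ) * m ≤ 2 * m := by nlinarith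
  by_contra hlt
  push Not at hlt
  have hm0 : m = 0 := by linarith
  have h0 := sum_mul_mult_eq_zero (α := α) hp (by linarith) (.inr q)
  rw [hm0] at htn
  linarith

/-- Rigidity of the values `η` of a facet functional on one of the families `y`, `u`, when those on
the other family are equal to `1` and the sum of those on the family is maximal. -/
lemma rigidity {c : Fin k → Fin b → ℕ} {η : Fin b → ℝ} {p : Fin k → ℝ} {q : Fin b}
    (hp : ∀ j, 0 < p j) (hs : ∀ o ≠ q, ∑ j, p j * c j o < ∑ j, p j * c j q)
    (hη : ∀ o ≠ q, η o ≤ 1) (hsum : ∑ o, η o = b + 1)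
    (hc : ∀ j, ∑ o, (c j o : ℝ) * (η o - 1) ≤ 1) :
    (∀ o ≠ q, η o = 1) ∧ ∀ j, c j q ≠ 0 → c j q = 1 := by
  have hd : ∀ o ∈ Finset.univ.erase q, 0 ≤ 1 - η o := fun o ho => by
    linarith [hη o (Finset.ne_of_mem_erase ho)]
  have hηq : η q - 1 = 1 + ∑ o ∈ Finset.univ.erase q, (1 - η o) := by
    have h := Finset.add_sum_erase Finset.univ (fun o => 1 - η o) (Finset.mem_univ q)
    simp only [Finset.sum_sub_distrib, Finset.sum_const, Finset.card_univ, Fintype.card_fin,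
      nsmul_one, hsum] at h ⊢
    linarith
  have hε : ∀ j, (0 : ℝ) ≤ c j q - (if c j q = 0 then 0 else 1) := fun j => by
    split_ifs with h
    · simp
    · have : (1 : ℝ) ≤ c j q := by exact_mod_cast Nat.one_le_iff_ne_zero.2 h
      linarith
  have hj : ∀ j, p j * (c j q - (if c j q = 0 then 0 else 1)) +
      ∑ o ∈ Finset.univ.erase q, p j * (c j q - c j o) * (1 - η o) ≤ 0 := fun j => by
    have h1 : ∑ o ∈ Finset.univ.erase q, ((c j q : ℝ) - c j o) * (1 - η o) =
        c j q * ∑ o ∈ Finset.univ.erase q, (1 - η o) +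
          ∑ o ∈ Finset.univ.erase q, (c j o : ℝ) * (η o - 1) := by
      rw [Finset.mul_sum, ← Finset.sum_add_distrib]
      exact Finset.sum_congr rfl fun o _ => by ring
    have h2 := hc j
    rw [← Finset.add_sum_erase _ _ (Finset.mem_univ q), hηq] at h2
    simp_rw [mul_assoc]
    rw [← Finset.mul_sum, ← mul_add, h1]
    refine mul_nonpos_of_nonneg_of_nonpos (hp j).le ?_
    split_ifs with h
    · have : ∑ o ∈ Finset.univ.erase q, (c j o : ℝ) * (η o - 1) ≤ 0 :=
        Finset.sum_nonpos fun o ho => mul_nonpos_of_nonneg_of_nonpos (Nat.cast_nonneg _)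
          (by linarith [hd o ho])
      simpa [h] using this
    · linarith
  have hterm : ∀ o ∈ Finset.univ.erase q,
      0 ≤ (∑ j, p j * c j q - ∑ j, p j * c j o) * (1 - η o) := fun o ho =>
    mul_nonneg (sub_nonneg.2 (hs o (Finset.ne_of_mem_erase ho)).le) (hd o ho)
  have hterm' : ∀ j ∈ Finset.univ, 0 ≤ p j * (c j q - (if c j q = 0 then (0 : ℝ) else 1)) :=
    fun j _ => mul_nonneg (hp j).le (hε j)
  have htot : ∑ j, p j * (c j q - (if c j q = 0 then (0 : ℝ) else 1)) +
      ∑ o ∈ Finset.univ.erase q, (∑ j, p j * c j q - ∑ j, p j * c j o) * (1 - η o) ≤ 0 := by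
    refine le_trans (le_of_eq ?_) (Finset.sum_nonpos fun j (_ : j ∈ Finset.univ) => hj j)
    rw [Finset.sum_add_distrib, Finset.sum_comm (s := Finset.univ) (t := Finset.univ.erase q)]
    congr 1
    refine Finset.sum_congr rfl fun o _ => ?_
    rw [← Finset.sum_mul, ← Finset.sum_sub_distrib]
    congr 1
    exact Finset.sum_congr rfl fun j _ => by ring
  have hA := Finset.sum_nonneg hterm
  have hB := Finset.sum_nonneg hterm'
  have hA0 := (Finset.sum_eq_zero_iff_of_nonneg hterm).1 (by linarith)
  have hB0 := (Finset.sum_eq_zero_iff_of_nonneg hterm').1 (by linarith)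
  refine ⟨fun o ho => ?_, fun j hj0 => ?_⟩
  · rcases mul_eq_zero.1 (hA0 o (Finset.mem_erase.2 ⟨ho, Finset.mem_univ o⟩)) with h | h
    · linarith [hs o ho]
    · linarith
  · have h := (mul_eq_zero.1 (hB0 j (Finset.mem_univ j))).resolve_left (hp j).ne'
    rw [if_neg hj0] at h
    exact_mod_cast sub_eq_zero.1 h

/-- Let `side`, `other` be the two families `y`, `u` in some order. If the functional `φ` is `1` on
the second one and its sum over the first one is maximal, then functionals `D` vanishing on the
points where `φ` is `1` vanish on the whole first family. -/
lemma dual_apply_eq_zero {side other : Fin b → Fin b ⊕ Fin b}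
    (hsplit : ∀ f : Fin b ⊕ Fin b → ℝ, ∑ σ, f σ = ∑ o, f (side o) + ∑ o, f (other o))
    {q : Fin b} {p : Fin k → ℝ} (hp : ∀ j, 0 < p j)
    (hs : ∀ o ≠ q, ∑ j, p j * mult α j (side o) < ∑ j, p j * mult α j (side q))
    (hα : ∃ j i, α j i = side q) {φ D : (Fin (dim a b k l) → ℝ) →ₗ[ℝ] ℝ}
    (hother : ∀ o, φ (X a b k l (other o)) = 1) (hside : ∀ o ≠ q, φ (X a b k l (side o)) ≤ 1)
    (hw : ∀ j i, φ (w a b k l α j i) ≤ 1) (hsum : ∑ o, φ (X a b k l (side o)) = b + 1)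
    (hDother : ∀ o, D (X a b k l (other o)) = 0)
    (hDside : ∀ o ≠ q, φ (X a b k l (side o)) = 1 → D (X a b k l (side o)) = 0)
    (hDw : ∀ j i, φ (w a b k l α j i) = 1 → D (w a b k l α j i) = 0) :
    ∀ o, D (X a b k l (side o)) = 0 := by
  have hsumw : ∀ (ψ : (Fin (dim a b k l) → ℝ) →ₗ[ℝ] ℝ) (j), ∑ i, ψ (w a b k l α j i) =
      ∑ o, (mult α j (side o) : ℝ) * ψ (X a b k l (side o)) +
        ∑ o, (mult α j (other o) : ℝ) * ψ (X a b k l (other o)) := fun ψ j => by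
    rw [← map_sum, sum_w, map_sum, sum_comp_eq_sum_mult α j fun σ => ψ (X a b k l σ), hsplit]
  have hφw : ∀ j, ∑ i, φ (w a b k l α j i) =
      l j + ∑ o, (mult α j (side o) : ℝ) * (φ (X a b k l (side o)) - 1) := fun j => by
    rw [hsumw, ← sum_mult α j, hsplit]
    simp only [hother, mul_sub, mul_one, Finset.sum_sub_distrib]
    ring
  obtain ⟨hη, hmult⟩ := rigidity (c := fun j o => mult α j (side o))
    (η := fun o => φ (X a b k l (side o))) hp hs hside hsum fun j => by
      have h : ∑ i, φ (w a b k l α j i) ≤ ∑ i : Fin (l j + 1), (1 : ℝ) :=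
        Finset.sum_le_sum fun i _ => hw j i
      rw [hφw] at h
      simp only [Finset.sum_const, Finset.card_univ, Fintype.card_fin, nsmul_one] at h
      push_cast at h
      linarith
  obtain ⟨j, i, hji⟩ := hα
  have hm : mult α j (side q) = 1 := hmult j (Finset.card_ne_zero_of_mem (a := i) (by simp [hji]))
  have hφq : φ (X a b k l (side q)) = 2 := by
    rw [← Finset.add_sum_erase _ _ (Finset.mem_univ q),
      Finset.sum_congr rfl fun o ho => hη o (Finset.ne_of_mem_erase ho), Finset.sum_const,
      Finset.card_erase_of_mem (Finset.mem_univ q), Finset.card_univ, Fintype.card_fin, nsmul_one,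
      Nat.cast_sub q.pos] at hsum
    push_cast at hsum
    linarith
  have hwj : ∀ i, φ (w a b k l α j i) = 1 := by
    have h : ∑ i, φ (w a b k l α j i) = ∑ i : Fin (l j + 1), (1 : ℝ) := by
      rw [hφw, Finset.sum_eq_single q]
      · simp only [hm, hφq, Finset.sum_const, Finset.card_univ, Fintype.card_fin, nsmul_one]
        push_cast
        ring
      · intro o _ ho
        simp [hη o ho]
      · simp
    exact fun i => (Finset.sum_eq_sum_iff_of_le fun i _ => hw j i).1 h i (Finset.mem_univ i)
  have hD := hsumw D j
  rw [Finset.sum_eq_zero fun i _ => hDw j i (hwj i), Finset.sum_eq_single q] at hD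
  · have hDq : D (X a b k l (side q)) = 0 := by simpa [hm, hDother] using hD.symm
    intro o
    by_cases ho : o = q
    exacts [ho ▸ hDq, hDside o ho (hη o ho)]
  · intro o _ ho
    simp [hDside o ho (hη o ho)]
  · simp

variable {Q : Set (Fin (dim a b k l) → ℝ)}

lemma dim_pos (ha : 2 ≤ a) : 0 < dim a b k l := by
  unfold dim; omega

lemma removed_ne_t (ha : 2 ≤ a) (hb : 1 ≤ b) (hQ : IsSmoothFano Q) :
    ¬ ParametrizesVertices Q (point a b k l α) lt := by
  classical
  intro hx
  let q₀ : Fin b := ⟨0, hb⟩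
  let S : Finset (Label a b k l) := Finset.univ.filter fun i =>
    i ≠ lt ∧ i ≠ lz ∧ i ≠ lX (.inr q₀) ∧ ∀ j, i ≠ lw j (Fin.last _)
  obtain ⟨φ, -, hint, -, hφ | ⟨g, hgt, -, hg, hdeg, hrel⟩⟩ :=
    hx.exists_facet (dim_pos ha) hQ S (by simp [S])
  · have hv : ∀ i, φ (v a b k l i) = 1 := fun i => hφ (.inl i) (by simp [S])
    have hy : ∀ i, φ (y a b k l i) = 1 := fun i => hφ (lX (.inl i)) (by simp [S])
    obtain ⟨m, hm⟩ := hint lz (by simp)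
    have hzt := congrArg φ (z_add_t a b k l)
    have hvy := congrArg φ (sum_v_add_sum_y k l (by omega : 1 ≤ a) hb)
    change φ (z a b k l) = m at hm
    simp only [map_add, map_sum, map_smul, map_zero, hv, hy, hm, Finset.sum_const,
      Finset.card_univ, Fintype.card_fin, nsmul_one, smul_eq_mul] at hzt hvy
    rw [← neg_eq_iff_add_eq_zero.2 hzt] at hvy
    have hZ : (a : ℤ) + b = (a + b - 1) * -m := by exact_mod_cast hvy
    have hdvd : (a + b - 1 : ℤ) ∣ 1 := ⟨-m - 1, by linarith⟩
    have := Int.le_of_dvd one_pos hdvd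
    omega
  · have := degree_nonpos_of_removed_t ha hb hrel q₀ (hg _ (by simp [S])) (hg _ (by simp [S]))
      (fun j => hg _ (by simp [S])) hgt
    linarith

lemma removed_ne_y (ha : 2 ≤ a) (hb : 1 ≤ b) (hα : ∀ s, ∃ j i, α j i = s) (hQ : IsSmoothFano Q)
    (q : Fin b) : ¬ ParametrizesVertices Q (point a b k l α) (lX (.inl q)) := by
  intro hx
  obtain ⟨c, hc0, hcpos, hcrel⟩ := hx.exists_pos_relation hQ
  obtain ⟨m, n, p, -, hp, hyc, -⟩ := point_relation_coeffs (by omega) hb hcrel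
  let S : Finset (Label a b k l) := Finset.univ.filter fun i =>
    i = lt ∨ ∃ r, i = lX (.inr r)
  obtain ⟨φ, hle, -, hD, hφ | ⟨g, hg0, hg1, hg, hdeg, hrel⟩⟩ :=
    hx.exists_facet (dim_pos ha) hQ S (by simp [S])
  · have hu : ∀ o, φ (u a b k l o) = 1 := fun o => hφ (lX (.inr o)) (by simp [S])
    have ht : φ (t a b k l) = 1 := hφ lt (by simp [S])
    obtain ⟨D, hD1, hD0⟩ := hD lt (by simp) ht
    have hDu : ∀ o, D (u a b k l o) = 0 := fun o => hD0 (lX (.inr o)) (by simp) (by simp) (hu o)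
    change D (t a b k l) = 1 at hD1
    have hφsum := congrArg φ (sum_u_add_t k l (by omega : 1 ≤ a) hb)
    have hDsum := congrArg D (sum_u_add_t k l (by omega : 1 ≤ a) hb)
    simp only [map_add, map_sum, hu, ht, hDu, hD1, Finset.sum_const, Finset.card_univ,
      Fintype.card_fin, nsmul_one, smul_zero, zero_add] at hφsum hDsum
    have hlt : ∀ o ≠ q, ∑ j, p j * mult α j (.inl o) < ∑ j, p j * mult α j (.inl q) := by
      intro o ho
      have h1 := hcpos (lX (.inl o)) (by simpa using ho)
      rw [hyc] at h1 hc0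
      linarith
    have hyo : ∀ o ≠ q, φ (y a b k l o) = 1 → D (y a b k l o) = 0 := fun o ho h =>
      hD0 (lX (.inl o)) (by simpa using ho) (by simp) h
    have hDy := dual_apply_eq_zero (side := .inl) (other := .inr) Fintype.sum_sum_type
      (fun j => hp j 0 ▸ hcpos (lw j 0) (by simp)) hlt (hα _) hu
      (fun o ho => hle (lX (.inl o)) (by simpa using ho)) (fun j i => hle (lw j i) (by simp))
      hφsum.symm hDu hyo (fun j i h => hD0 (lw j i) (by simp) (by simp) h)
    change ∀ o, D (y a b k l o) = 0 at hDy
    simp only [hDy, Finset.sum_const_zero] at hDsum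
    exact one_ne_zero hDsum
  · have := degree_lt_one_of_removed_y ha hb hrel q hg0 (fun i => hg _ (by simp [S]))
      (fun r => hg1 _ (by simp [S])) (hg _ (by simp [S])) (fun j i => hg _ (by simp [S]))
    linarith

lemma removed_ne_u (ha : 2 ≤ a) (hb : 1 ≤ b) (hα : ∀ s, ∃ j i, α j i = s) (hQ : IsSmoothFano Q)
    (q : Fin b) : ¬ ParametrizesVertices Q (point a b k l α) (lX (.inr q)) := by
  intro hx
  obtain ⟨c, hc0, hcpos, hcrel⟩ := hx.exists_pos_relation hQ
  obtain ⟨m, n, p, -, hp, -, huc, -⟩ := point_relation_coeffs (by omega) hb hcrel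
  let S : Finset (Label a b k l) := Finset.univ.filter fun i =>
    i = lz ∨ ∃ r, i = lX (.inl r)
  obtain ⟨φ, hle, -, hD, hφ | ⟨g, hg0, hg1, hg, hdeg, hrel⟩⟩ :=
    hx.exists_facet (dim_pos ha) hQ S (by simp [S])
  · have hy : ∀ o, φ (y a b k l o) = 1 := fun o => hφ (lX (.inl o)) (by simp [S])
    have hz : φ (z a b k l) = 1 := hφ lz (by simp [S])
    obtain ⟨D, hD1, hD0⟩ := hD lz (by simp) hz
    have hDy : ∀ o, D (y a b k l o) = 0 := fun o => hD0 (lX (.inl o)) (by simp) (by simp) (hy o)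
    change D (z a b k l) = 1 at hD1
    have hsum : ∑ i, y a b k l i + z a b k l = ∑ i, u a b k l i := by
      rw [← sum_u_add_t k l (by omega : 1 ≤ a) hb, add_assoc, add_comm (t a b k l), z_add_t,
        add_zero]
    have hφsum := congrArg φ hsum
    have hDsum := congrArg D hsum
    simp only [map_add, map_sum, hy, hz, hDy, hD1, Finset.sum_const, Finset.card_univ,
      Fintype.card_fin, nsmul_one, smul_zero, zero_add] at hφsum hDsum
    have hlt : ∀ o ≠ q, ∑ j, p j * mult α j (.inr o) < ∑ j, p j * mult α j (.inr q) := by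
      intro o ho
      have h1 := hcpos (lX (.inr o)) (by simpa using ho)
      rw [huc] at h1 hc0
      linarith
    have huo : ∀ o ≠ q, φ (u a b k l o) = 1 → D (u a b k l o) = 0 := fun o ho h =>
      hD0 (lX (.inr o)) (by simpa using ho) (by simp) h
    have hDu := dual_apply_eq_zero (side := .inr) (other := .inl)
      (fun f => (Fintype.sum_sum_type f).trans (add_comm _ _))
      (fun j => hp j 0 ▸ hcpos (lw j 0) (by simp)) hlt (hα _) hy
      (fun o ho => hle (lX (.inr o)) (by simpa using ho)) (fun j i => hle (lw j i) (by simp))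
      hφsum.symm hDy huo (fun j i h => hD0 (lw j i) (by simp) (by simp) h)
    change ∀ o, D (u a b k l o) = 0 at hDu
    simp only [hDu, Finset.sum_const_zero] at hDsum
    exact one_ne_zero hDsum
  · have := degree_lt_one_of_removed_u ha hb hrel q hg0 (fun i => hg _ (by simp [S]))
      (fun r => hg1 _ (by simp [S])) (hg1 _ (by simp [S])) (hg _ (by simp [S]))
      (fun j i => hg _ (by simp [S]))
    linarith

lemma removed_ne_v (ha : 2 ≤ a) (hb : 1 ≤ b) (hQ : IsSmoothFano Q) (i : Fin a) :
    ¬ ParametrizesVertices Q (point a b k l α) (.inl i) := by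
  intro hx
  obtain ⟨c, hc0, hcpos, hcrel⟩ := hx.exists_pos_relation hQ
  obtain ⟨m, -, -, hv, -⟩ := point_relation_coeffs (by omega) hb hcrel
  have : Nontrivial (Fin a) := Fin.nontrivial_iff_two_le.2 ha
  obtain ⟨i', hi'⟩ := exists_ne i
  have := hcpos (.inl i') (by simpa using hi')
  rw [hv] at hc0 this
  exact this.ne' hc0

lemma removed_ne_w (ha : 2 ≤ a) (hb : 1 ≤ b) (hl : ∀ j, 1 ≤ l j) (hQ : IsSmoothFano Q)
    (j : Fin k) (i : Fin (l j + 1)) : ¬ ParametrizesVertices Q (point a b k l α) (lw j i) := by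
  intro hx
  obtain ⟨c, hc0, hcpos, hcrel⟩ := hx.exists_pos_relation hQ
  obtain ⟨-, -, p, -, hw, -⟩ := point_relation_coeffs (by omega) hb hcrel
  have : Nontrivial (Fin (l j + 1)) := Fin.nontrivial_iff_two_le.2 (by have := hl j; omega)
  obtain ⟨i', hi'⟩ := exists_ne i
  have := hcpos (lw j i') (by simpa using hi')
  rw [hw] at hc0 this
  exact this.ne' hc0

lemma removed_ne_z (ha : 2 ≤ a) (hb : 1 ≤ b) (hQ : IsSmoothFano Q) :
    ¬ ParametrizesVertices Q (point a b k l α) lz := by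
  intro hx
  obtain ⟨c, hc0, hcpos, hcrel⟩ := hx.exists_pos_relation hQ
  obtain ⟨m, n, p, hv, hw, hy, -, ht, -⟩ := point_relation_coeffs (by omega) hb hcrel
  have hm : 0 < m := hv ⟨0, by omega⟩ ▸ hcpos (.inl _) (by simp)
  have hyq := hcpos (lX (.inl ⟨0, hb⟩)) (by simp)
  have htpos := hcpos lt (by simp)
  have hs : 0 ≤ ∑ j, p j * mult α j (.inl ⟨0, hb⟩) := Finset.sum_nonneg fun j _ =>
    mul_nonneg (hw j 0 ▸ (hcpos (lw j 0) (by simp)).le) (Nat.cast_nonneg _)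
  rw [hy] at hyq
  rw [ht, hc0] at htpos
  have hab : (3 : ℝ) ≤ a + b := by exact_mod_cast (by omega : 3 ≤ a + b)
  nlinarith

end PG

/-- For `a ≥ 2`, `b ≥ 1`, `k ≥ 1`, `l_1, …, l_k ≥ 1`, any
assignment `α` as in the construction, and `n = a + 2b - 1 + ∑ l_j`, there is
no smooth Fano `n`-polytope `Q` with `n + k + 2` vertices such that
`V(Q) ⊆ V(P(a, b, k, l, α))`. -/
theorem no_smooth_Fano_subpolytope_of_PG (a b k : ℕ) (l : Fin k → ℕ)
    (ha : 2 ≤ a) (hb : 1 ≤ b) (hk : 1 ≤ k) (hl : ∀ j, 1 ≤ l j)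
    (α : (j : Fin k) → Fin (l j) → (Fin b ⊕ Fin b))
    (hα : ∀ s : Fin b ⊕ Fin b, ∃ j i, α j i = s) :
    ¬ ∃ Q : Set (Fin (PG.dim a b k l) → ℝ), IsSmoothFano Q ∧
      (vertexSet Q).ncard = PG.dim a b k l + k + 2 ∧
      vertexSet Q ⊆ vertexSet (PG.P a b k l α) := by
  rintro ⟨Q, hQ, hcard, hsub⟩
  have hfin := finite_vertexSet hQ.1
  obtain ⟨i₀, himage, hinj⟩ := exists_image_erase (V := hfin.toFinset) (x := PG.point a b k l α)
    (by rw [hfin.coe_toFinset]; exact hsub.trans PG.vertexSet_P_subset)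
    (by rw [PG.card_label (by omega), ← Set.ncard_eq_toFinset_card _ hfin, hcard])
  have hx : ParametrizesVertices Q (PG.point a b k l α) i₀ :=
    ⟨by rw [← himage, hfin.coe_toFinset], hinj⟩
  obtain i | (q | q) | (_ | _) | ⟨j, i⟩ := i₀
  · exact PG.removed_ne_v ha hb hQ i hx
  · exact PG.removed_ne_y ha hb hα hQ q hx
  · exact PG.removed_ne_u ha hb hα hQ q hx
  · exact PG.removed_ne_z ha hb hQ hx
  · exact PG.removed_ne_t ha hb hQ hx
  · exact PG.removed_ne_w ha hb hl hQ j i hx
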